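/- There exists an absolute constant C₃ > 0 such that for every δ ≥ 1 there is a constant γ₂(δ) > 0 (depending only on δ) with the following property: for every unidirectional Stokes wave solution (ψ, η, r) with γ > γ₂(δ), R(s_c) < r < R(0), and ψ_y(x, η(x)) ≥ √(2γ) − δ/γ for all x ∈ ℝ, every y⋆ ∈ (0, η(0)) satisfying ψ_y(0, y⋆) = 1/γ obeys y⋆ < C₃·√δ/γ². -/

import Mathlib

noncomputable section

open Real Set

/-- Partial derivative of `ψ` in the horizontal variable. -/
def px (ψ : ℝ → ℝ → ℝ) (x y : ℝ) : ℝ := deriv (fun t => ψ t y) x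

/-- Partial derivative of `ψ` in the vertical variable. -/
def py (ψ : ℝ → ℝ → ℝ) (x y : ℝ) : ℝ := deriv (fun t => ψ x t) y

/-- Second partial derivative in `x`. -/
def pxx (ψ : ℝ → ℝ → ℝ) (x y : ℝ) : ℝ := deriv (fun t => px ψ t y) x

/-- Second partial derivative in `y`. -/
def pyy (ψ : ℝ → ℝ → ℝ) (x y : ℝ) : ℝ := deriv (fun t => py ψ x t) y

/-- Depth `d(s)` of the laminar (stream) flow with surface value `s` of `ψ_y`. -/
def lamDepth (γ s : ℝ) : ℝ := (-s + Real.sqrt (s ^ 2 + 2 * γ)) / γ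

/-- Bernoulli constant `R(s) = ½ s² + γ + d(s)` of the laminar flow. -/
def bernR (γ s : ℝ) : ℝ := s ^ 2 / 2 + γ + lamDepth γ s

/-- `s` is the (unique) positive critical point `s_c` of `R`, characterized by the
equation `s - 1/γ + s/(γ √(s² + 2γ)) = 0`. -/
def IsCrit (γ s : ℝ) : Prop :=
  0 < s ∧ s - 1 / γ + s / (γ * Real.sqrt (s ^ 2 + 2 * γ)) = 0

/-- A solution `(ψ, η, r)` of the stream-function formulation with constant adverse
vorticity `ω = -γ`:  `Δψ = γ` in the fluid domain `D_η`, the Bernoulli condition on the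
surface, `ψ = 1` on the surface and `ψ = 0` on the flat bottom. -/
structure StreamSolution (γ : ℝ) (ψ : ℝ → ℝ → ℝ) (η : ℝ → ℝ) (r : ℝ) : Prop where
  eta_smooth : ContDiff ℝ (⊤ : ℕ∞) η
  eta_pos : ∀ x, 0 < η x
  psi_smooth : ContDiff ℝ (⊤ : ℕ∞) (fun p : ℝ × ℝ => ψ p.1 p.2)
  laplace : ∀ x y, 0 < y → y < η x → pxx ψ x y + pyy ψ x y = γ
  bernoulli : ∀ x, (px ψ x (η x)) ^ 2 / 2 + (py ψ x (η x)) ^ 2 / 2 + η x = r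
  surface_val : ∀ x, ψ x (η x) = 1
  bottom_val : ∀ x, ψ x 0 = 0

/-- The flow is unidirectional: `ψ_y > 0` everywhere in the fluid domain `D_η`. -/
def Unidirectional (ψ : ℝ → ℝ → ℝ) (η : ℝ → ℝ) : Prop :=
  ∀ x y, 0 < y → y < η x → 0 < py ψ x y

/-- A Stokes wave with half-period `Λ`: the solution is `2Λ`-periodic and even in `x`,
and the surface profile is strictly decreasing from the crest (`x = 0`) to the
trough (`x = Λ`).  Thus `η̂ = max η = η 0` and `η̌ = min η = η Λ`. -/
structure StokesWave (γ : ℝ) (ψ : ℝ → ℝ → ℝ) (η : ℝ → ℝ) (r Λ : ℝ) : Prop where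
  sol : StreamSolution γ ψ η r
  lam_pos : 0 < Λ
  eta_periodic : ∀ x, η (x + 2 * Λ) = η x
  eta_even : ∀ x, η (-x) = η x
  psi_periodic : ∀ x y, ψ (x + 2 * Λ) y = ψ x y
  psi_even : ∀ x y, ψ (-x) y = ψ x y
  eta_anti : StrictAntiOn η (Set.Icc 0 Λ)

/-- A solitary wave (relative to the critical value `sc = s_c` of `γ`): the solution is
even in `x`, the profile is strictly decreasing on `(0, ∞)` and non-constant, and the
flow converges to a supercritical laminar flow `(U(·; s), d(s))` with `s > s_c`,
`R(s) = r` as `|x| → ∞`.  The crest is at `x = 0`, `η̂ = η 0` and `η̌ = inf η = d(s)`. -/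
structure SolitaryWave (γ sc : ℝ) (ψ : ℝ → ℝ → ℝ) (η : ℝ → ℝ) (r : ℝ) : Prop where
  sol : StreamSolution γ ψ η r
  eta_even : ∀ x, η (-x) = η x
  psi_even : ∀ x y, ψ (-x) y = ψ x y
  eta_anti : StrictAntiOn η (Set.Ioi 0)
  nonconst : ∃ x₁ x₂, η x₁ ≠ η x₂
  asymptotic : ∃ s, sc < s ∧ bernR γ s = r ∧
    ∀ ε > 0, ∃ X : ℝ, ∀ x : ℝ, X ≤ |x| →
      |η x - lamDepth γ s| ≤ ε ∧
      ∀ y ∈ Set.Icc 0 (η x), |px ψ x y| + |py ψ x y - (γ * y + s)| ≤ ε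

lemma snd_test (g g' : ℝ → ℝ) (c x : ℝ) (h1 : ∀ t, HasDerivAt g (g' t) t)
    (h2 : HasDerivAt g' c x) (hm : IsLocalMin g x) : 0 ≤ c := by
  by_contra hc
  push Not at hc
  have e : deriv g = g' := funext fun t => (h1 t).deriv
  have h0 : deriv g x = 0 := hm.deriv_eq_zero
  have hmax : IsLocalMax g x := by
    apply isLocalMax_of_deriv_deriv_neg _ h0 (h1 x).continuousAt
    rw [e, h2.deriv]; exact hc
  have hconst : g =ᶠ[nhds x] fun _ => g x := by
    filter_upwards [hm, hmax] with t h3 h4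
    exact le_antisymm h4 h3
  have hd : deriv g =ᶠ[nhds x] deriv (fun _ : ℝ => g x) := hconst.deriv
  rw [e] at hd
  have := hd.deriv_eq
  rw [h2.deriv] at this
  simp at this
  linarith

def Sm (f : ℝ → ℝ → ℝ) : Prop := ContDiff ℝ (⊤ : ℕ∞) (fun p : ℝ × ℝ => f p.1 p.2)

lemma Sm.diff {f : ℝ → ℝ → ℝ} (hf : Sm f) (p : ℝ × ℝ) :
    DifferentiableAt ℝ (fun p : ℝ × ℝ => f p.1 p.2) p :=
  (ContDiff.differentiable hf (by simp)) p

lemma hasx0 {f : ℝ → ℝ → ℝ} (hf : Sm f) (x y : ℝ) :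
    HasDerivAt (fun t => f t y) (fderiv ℝ (fun p : ℝ × ℝ => f p.1 p.2) (x, y) (1, 0)) x := by
  have h := (hf.diff (x, y)).hasFDerivAt
  have h2 : HasDerivAt (fun t : ℝ => (t, y)) ((1 : ℝ), (0 : ℝ)) x :=
    (hasDerivAt_id x).prodMk (hasDerivAt_const x y)
  exact h.comp_hasDerivAt x h2

lemma hasy0 {f : ℝ → ℝ → ℝ} (hf : Sm f) (x y : ℝ) :
    HasDerivAt (fun t => f x t) (fderiv ℝ (fun p : ℝ × ℝ => f p.1 p.2) (x, y) (0, 1)) y := by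
  have h := (hf.diff (x, y)).hasFDerivAt
  have h2 : HasDerivAt (fun t : ℝ => (x, t)) ((0 : ℝ), (1 : ℝ)) y :=
    (hasDerivAt_const y x).prodMk (hasDerivAt_id y)
  exact h.comp_hasDerivAt y h2

lemma px_eq {f : ℝ → ℝ → ℝ} (hf : Sm f) (x y : ℝ) :
    px f x y = fderiv ℝ (fun p : ℝ × ℝ => f p.1 p.2) (x, y) (1, 0) := (hasx0 hf x y).deriv

lemma py_eq {f : ℝ → ℝ → ℝ} (hf : Sm f) (x y : ℝ) :
    py f x y = fderiv ℝ (fun p : ℝ × ℝ => f p.1 p.2) (x, y) (0, 1) := (hasy0 hf x y).deriv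

lemma hasx {f : ℝ → ℝ → ℝ} (hf : Sm f) (x y : ℝ) :
    HasDerivAt (fun t => f t y) (px f x y) x := by
  rw [px_eq hf]; exact hasx0 hf x y

lemma hasy {f : ℝ → ℝ → ℝ} (hf : Sm f) (x y : ℝ) :
    HasDerivAt (fun t => f x t) (py f x y) y := by
  rw [py_eq hf]; exact hasy0 hf x y

lemma Sm.fd {f : ℝ → ℝ → ℝ} (hf : Sm f) :
    ContDiff ℝ (⊤ : ℕ∞) (fderiv ℝ (fun p : ℝ × ℝ => f p.1 p.2)) :=
  ContDiff.fderiv_right (m := (⊤ : ℕ∞)) hf (by simp)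

lemma Sm.px {f : ℝ → ℝ → ℝ} (hf : Sm f) : Sm (px f) := by
  have e : (fun p : ℝ × ℝ => _root_.px f p.1 p.2) =
      fun p => fderiv ℝ (fun p : ℝ × ℝ => f p.1 p.2) p (1, 0) := by
    funext p; exact px_eq hf p.1 p.2
  unfold Sm
  rw [e]
  exact hf.fd.clm_apply contDiff_const

lemma Sm.py {f : ℝ → ℝ → ℝ} (hf : Sm f) : Sm (py f) := by
  have e : (fun p : ℝ × ℝ => _root_.py f p.1 p.2) =
      fun p => fderiv ℝ (fun p : ℝ × ℝ => f p.1 p.2) p (0, 1) := by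
    funext p; exact py_eq hf p.1 p.2
  unfold Sm
  rw [e]
  exact hf.fd.clm_apply contDiff_const

lemma Sm.comm {f : ℝ → ℝ → ℝ} (hf : Sm f) : _root_.px (_root_.py f) = _root_.py (_root_.px f) := by
  funext x y
  have e1 : (fun p : ℝ × ℝ => _root_.px f p.1 p.2) =
      fun p => fderiv ℝ (fun p : ℝ × ℝ => f p.1 p.2) p (1, 0) := by
    funext p; exact px_eq hf p.1 p.2
  have e2 : (fun p : ℝ × ℝ => _root_.py f p.1 p.2) =
      fun p => fderiv ℝ (fun p : ℝ × ℝ => f p.1 p.2) p (0, 1) := by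
    funext p; exact py_eq hf p.1 p.2
  rw [px_eq hf.py, py_eq hf.px, e1, e2]
  have hd : DifferentiableAt ℝ (fderiv ℝ (fun p : ℝ × ℝ => f p.1 p.2)) (x, y) :=
    (hf.fd.differentiable (by simp)) _
  rw [fderiv_clm_apply hd (by fun_prop), fderiv_clm_apply hd (by fun_prop)]
  have hs : IsSymmSndFDerivAt ℝ (fun p : ℝ × ℝ => f p.1 p.2) (x, y) := by
    apply (ContDiff.contDiffAt hf).isSymmSndFDerivAt
    simp only [minSmoothness_of_isRCLikeNormedField]
    exact WithTop.coe_le_coe.mpr (le_top : (2 : ℕ∞) ≤ ⊤)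
  have := hs.eq (1, 0) (0, 1)
  simpa using this

/-- The harmonicity of `ψ_y`. -/
lemma lap_py {γ r : ℝ} {ψ : ℝ → ℝ → ℝ} {η : ℝ → ℝ} (h : StreamSolution γ ψ η r)
    (x y : ℝ) (hy : 0 < y) (hy' : y < η x) :
    px (px (py ψ)) x y + py (py (py ψ)) x y = 0 := by
  have hs : Sm ψ := h.psi_smooth
  have e : px (px (py ψ)) = py (px (px ψ)) := by
    rw [hs.comm, hs.px.comm]
  rw [e]
  have h1 := (hasy hs.px.px x y).add (hasy hs.py.py x y)
  have h2 : HasDerivAt (fun _ : ℝ => γ) 0 y := hasDerivAt_const y γ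
  refine h1.unique (h2.congr_of_eventuallyEq ?_)
  filter_upwards [Ioo_mem_nhds hy hy'] with t ht
  exact h.laplace x t ht.1 ht.2

lemma psi_mono {γ r : ℝ} {ψ : ℝ → ℝ → ℝ} {η : ℝ → ℝ} (h : StreamSolution γ ψ η r)
    (hu : Unidirectional ψ η) (x : ℝ) : StrictMonoOn (fun y => ψ x y) (Icc 0 (η x)) := by
  have hs : Sm ψ := h.psi_smooth
  apply strictMonoOn_of_deriv_pos (convex_Icc _ _)
  · exact fun y _ => (hasy hs x y).continuousAt.continuousWithinAt
  · intro y hy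
    rw [interior_Icc] at hy
    exact hu x y hy.1 hy.2

lemma surface_slope {γ r : ℝ} {ψ : ℝ → ℝ → ℝ} {η : ℝ → ℝ} (h : StreamSolution γ ψ η r)
    (hq : ∀ x, 0 < py ψ x (η x) ∧ r ≤ (py ψ x (η x)) ^ 2) (x : ℝ) : η 0 - |x| ≤ η x := by
  have hs : Sm ψ := h.psi_smooth
  have hη : Differentiable ℝ η := h.eta_smooth.differentiable (by simp)
  have hb : ∀ t, ‖deriv η t‖ ≤ 1 := by
    intro t
    have h1 : HasDerivAt (fun t => (t, η t)) ((1 : ℝ), deriv η t) t :=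
      (hasDerivAt_id t).prodMk (hη t).hasDerivAt
    have h2 := (hs.diff (t, η t)).hasFDerivAt.comp_hasDerivAt t h1
    have h3 : HasDerivAt (fun _ : ℝ => (1 : ℝ)) 0 t := hasDerivAt_const t 1
    have h4 := h2.unique (h3.congr_of_eventuallyEq
      (Filter.Eventually.of_forall fun s => h.surface_val s))
    have h5 : ((1 : ℝ), deriv η t) = (1, 0) + deriv η t • ((0 : ℝ), (1 : ℝ)) := by simp
    rw [h5, map_add, map_smul, ← px_eq hs, ← py_eq hs, smul_eq_mul] at h4
    have h6 := h.bernoulli t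
    have h7 := h.eta_pos t
    obtain ⟨h8, h9⟩ := hq t
    set a := px ψ t (η t)
    set b := py ψ t (η t)
    set c := deriv η t
    have h10 : a = - (c * b) := by linarith
    have h11 : c ^ 2 * b ^ 2 ≤ 1 * b ^ 2 := by
      rw [h10] at h6; nlinarith
    have h12 : c ^ 2 ≤ 1 := le_of_mul_le_mul_right h11 (by positivity)
    rw [Real.norm_eq_abs]
    exact abs_le_one_iff_mul_self_le_one.mpr (by nlinarith)
  have := Convex.norm_image_sub_le_of_norm_deriv_le (s := Set.univ) (f := η) (C := 1)
    (fun t _ => hη t) (fun t _ => hb t) convex_univ (mem_univ 0) (mem_univ x)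
  simp only [Real.norm_eq_abs, sub_zero, one_mul] at this
  have := (abs_le.mp this).1
  linarith

lemma depth_bound {γ r L : ℝ} {ψ : ℝ → ℝ → ℝ} {η : ℝ → ℝ} (hγ : 0 < γ)
    (h : StreamSolution γ ψ η r) (hu : Unidirectional ψ η)
    (hsl : ∀ x, η 0 - |x| ≤ η x) (hL : 0 < L) (hL2 : 5 ≤ γ * L ^ 2) : η 0 < 3 * L := by
  by_contra hc
  push Not at hc
  have hs : Sm ψ := h.psi_smooth
  let f : ℝ × ℝ → ℝ := fun p => γ / 5 * (p.1 ^ 2 + (p.2 - L) ^ 2) - ψ p.1 p.2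
  have hcont : Continuous f := by
    have : Continuous (fun p : ℝ × ℝ => ψ p.1 p.2) := ContDiff.continuous hs
    fun_prop
  obtain ⟨⟨x, y⟩, hK, hmin⟩ := (isCompact_Icc.prod isCompact_Icc : IsCompact
    (Icc (-L) L ×ˢ Icc 0 (2 * L))).exists_isMinOn ⟨(0, L), by
      constructor <;> constructor <;> simp <;> linarith⟩ hcont.continuousOn
  have h0 : f (x, y) ≤ f (0, L) := hmin (by constructor <;> constructor <;> simp <;> linarith)
  have hpos : 0 < ψ 0 L := by
    have := psi_mono h hu 0 (a := 0) (b := L) ⟨le_rfl, (h.eta_pos 0).le⟩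
      ⟨hL.le, by linarith⟩ hL
    simpa [h.bottom_val] using this
  obtain ⟨⟨hx1, hx2⟩, ⟨hy1, hy2⟩⟩ := hK
  simp only at hx1 hx2 hy1 hy2
  have hax : |x| ≤ L := abs_le.mpr ⟨hx1, hx2⟩
  have htop : 2 * L ≤ η x := by have := hsl x; linarith
  have hle : ψ x y ≤ 1 := by
    rw [← h.surface_val x]
    exact (psi_mono h hu x).monotoneOn ⟨hy1, by linarith⟩ ⟨(h.eta_pos x).le, le_rfl⟩ (by linarith)
  have hneg : γ / 5 * (x ^ 2 + (y - L) ^ 2) < 1 := by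
    simp only [f] at h0
    have : γ / 5 * ((0 : ℝ) ^ 2 + (L - L) ^ 2) = 0 := by ring
    linarith
  have hsq : x ^ 2 + (y - L) ^ 2 < L ^ 2 := by
    by_contra hcc
    push Not at hcc
    have : γ * L ^ 2 ≤ γ * (x ^ 2 + (y - L) ^ 2) := mul_le_mul_of_nonneg_left hcc hγ.le
    linarith
  have hxL : |x| < L := abs_lt_of_sq_lt_sq (by nlinarith [sq_nonneg (y - L)]) hL.le
  have hyL : |y - L| < L := abs_lt_of_sq_lt_sq (by nlinarith [sq_nonneg x]) hL.le
  rw [abs_lt] at hxL hyL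
  have t1 : 0 ≤ γ / 5 * 2 - px (px ψ) x y := by
    refine snd_test (fun t => f (t, y)) (fun t => γ / 5 * (2 * t) - px ψ t y) _ x ?_ ?_ ?_
    · intro t
      have := (((hasDerivAt_pow 2 t).add_const ((y - L) ^ 2)).const_mul (γ / 5)).sub (hasx hs t y)
      exact this.congr_deriv (by simp)
    · have := (((hasDerivAt_id x).const_mul 2).const_mul (γ / 5)).sub (hasx hs.px x y)
      exact this.congr_deriv (by simp)
    · filter_upwards [Ioo_mem_nhds hxL.1 hxL.2] with t ht
      exact hmin ⟨⟨ht.1.le, ht.2.le⟩, ⟨hy1, hy2⟩⟩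
  have t2 : 0 ≤ γ / 5 * 2 - py (py ψ) x y := by
    refine snd_test (fun t => f (x, t)) (fun t => γ / 5 * (2 * (t - L)) - py ψ x t) _ y ?_ ?_ ?_
    · intro t
      have := (((((hasDerivAt_id t).sub_const L).pow 2).const_add (x ^ 2)).const_mul
        (γ / 5)).sub (hasy hs x t)
      exact this.congr_deriv (by simp)
    · have := ((((hasDerivAt_id y).sub_const L).const_mul 2).const_mul (γ / 5)).sub
        (hasy hs.py x y)
      exact this.congr_deriv (by simp)
    · filter_upwards [Ioo_mem_nhds (show 0 < y by linarith) (show y < 2 * L by linarith)] with t ht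
      exact hmin ⟨⟨hx1, hx2⟩, ⟨ht.1.le, ht.2.le⟩⟩
  have hl : px (px ψ) x y + py (py ψ) x y = γ :=
    h.laplace x y (by linarith) (by linarith)
  linarith

lemma py_lower {γ r Λ A κ : ℝ} {ψ : ℝ → ℝ → ℝ} {η : ℝ → ℝ}
    (hw : StokesWave γ ψ η r Λ) (hu : Unidirectional ψ η) (hκ : 0 < κ)
    (hsurf : ∀ x, A * η x + κ * η x ^ 2 ≤ py ψ x (η x)) :
    ∀ x y, 0 ≤ y → y ≤ η x → A * y + κ * y ^ 2 ≤ py ψ x y := by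
  have h := hw.sol
  have hs : Sm ψ := h.psi_smooth
  have hηc : Continuous η := h.eta_smooth.continuous
  let f : ℝ × ℝ → ℝ := fun p => py ψ p.1 p.2 - (A * p.2 + κ * p.2 ^ 2)
  have hcont : Continuous f := by
    have : Continuous (fun p : ℝ × ℝ => py ψ p.1 p.2) := ContDiff.continuous hs.py
    fun_prop
  have hΛ := hw.lam_pos
  let K : Set (ℝ × ℝ) := Set.image (fun p : ℝ × ℝ => (p.1, p.2 * η p.1))
    (Icc 0 (2 * Λ) ×ˢ Icc 0 1)
  have hKc : IsCompact K := (isCompact_Icc.prod isCompact_Icc).image (by fun_prop)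
  have hKm : ∀ x y, 0 ≤ x → x ≤ 2 * Λ → 0 ≤ y → y ≤ η x → (x, y) ∈ K := by
    intro x y h1 h2 h3 h4
    have := h.eta_pos x
    refine ⟨(x, y / η x), ⟨⟨h1, h2⟩, ⟨by positivity, (div_le_one this).2 h4⟩⟩, ?_⟩
    simp [this.ne']
  obtain ⟨⟨x, y⟩, hK, hmin⟩ := hKc.exists_isMinOn
    ⟨(0, 0), hKm 0 0 le_rfl (by linarith) le_rfl (h.eta_pos 0).le⟩ hcont.continuousOn
  have hperpy : ∀ b, Function.Periodic (fun a => py ψ a b) (2 * Λ) := by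
    intro b a
    simp only [py, hw.psi_periodic]
  have hglob : ∀ a b, 0 ≤ b → b ≤ η a → f (x, y) ≤ f (a, b) := by
    intro a b h1 h2
    have hp : Function.Periodic (fun a => (η a, py ψ a b)) (2 * Λ) := fun a =>
      Prod.ext (hw.eta_periodic a) (hperpy b a)
    obtain ⟨a', ha', he⟩ := hp.exists_mem_Ico₀ (by linarith) a
    have he1 : η a = η a' := congrArg Prod.fst he
    have he2 : py ψ a b = py ψ a' b := congrArg Prod.snd he
    have : f (x, y) ≤ f (a', b) := hmin (hKm a' b ha'.1 ha'.2.le h1 (he1 ▸ h2))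
    simpa only [f, he2] using this
  have hxy : 0 ≤ y ∧ y ≤ η x := by
    obtain ⟨⟨a, b⟩, ⟨_, hb⟩, he⟩ := hK
    simp only [Prod.mk.injEq] at he
    obtain ⟨rfl, rfl⟩ := he
    have := h.eta_pos a
    exact ⟨mul_nonneg hb.1 this.le, mul_le_of_le_one_left this.le hb.2⟩
  have hfin : 0 ≤ f (x, y) := by
    rcases hxy.1.eq_or_lt with hy0 | hy0
    · subst hy0
      have hc : Continuous (fun t => py ψ x t) := by
        have : Continuous (fun p : ℝ × ℝ => py ψ p.1 p.2) := ContDiff.continuous hs.py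
        exact this.comp (by fun_prop : Continuous fun t : ℝ => (x, t))
      have hlim : Filter.Tendsto (fun t => py ψ x t) (nhdsWithin 0 (Ioi 0)) (nhds (py ψ x 0)) :=
        (hc.tendsto 0).mono_left nhdsWithin_le_nhds
      have : 0 ≤ py ψ x 0 := by
        refine ge_of_tendsto hlim ?_
        filter_upwards [Ioo_mem_nhdsGT (h.eta_pos x)] with t ht
        exact (hu x t ht.1 ht.2).le
      simpa [f] using this
    rcases hxy.2.eq_or_lt with hy1 | hy1
    · have := hsurf x
      simp only [f]
      rw [hy1]; linarith
    exfalso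
    have t1 : 0 ≤ px (px (py ψ)) x y := by
      refine snd_test (fun t => f (t, y)) (fun t => px (py ψ) t y) _ x ?_ (hasx hs.py.px x y) ?_
      · intro t
        exact (hasx hs.py t y).sub_const (A * y + κ * y ^ 2)
      · have : ∀ᶠ t in nhds x, y < η t := hηc.continuousAt.eventually (lt_mem_nhds hy1)
        filter_upwards [this] with t ht
        exact hglob t y hxy.1 ht.le
    have t2 : 0 ≤ py (py (py ψ)) x y - 2 * κ := by
      refine snd_test (fun t => f (x, t)) (fun t => py (py ψ) x t - (A + κ * (2 * t))) _ y
        ?_ ?_ ?_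
      · intro t
        have := (hasy hs.py x t).sub (((hasDerivAt_id t).const_mul A).add
          ((hasDerivAt_pow 2 t).const_mul κ))
        exact this.congr_deriv (by simp)
      · have := (hasy hs.py.py x y).sub
          ((((hasDerivAt_id y).const_mul 2).const_mul κ).const_add A)
        exact this.congr_deriv (by simp; ring)
      · filter_upwards [Ioo_mem_nhds hy0 hy1] with t ht
        exact hglob x t ht.1.le ht.2.le
    have := lap_py h x y hy0 hy1
    linarith
  intro a b h1 h2
  have := hglob a b h1 h2
  simp only [f] at this hfin
  linarith

/-- Proposition 2.6: if `ψ_y ≥ √(2γ) - δ/γ` everywhere on the surface and `γ > γ₂(δ)`,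
then every `y⋆ ∈ (0, η(0))` with `ψ_y(0, y⋆) = 1/γ` satisfies `y⋆ < C₃ √δ / γ²`. -/
theorem ystar_bound :
    ∃ C₃ > (0 : ℝ), ∀ δ ≥ (1 : ℝ), ∃ γ₂ > (0 : ℝ), ∀ γ > γ₂,
      ∀ (ψ : ℝ → ℝ → ℝ) (η : ℝ → ℝ) (r Λ sc : ℝ),
        StokesWave γ ψ η r Λ → Unidirectional ψ η → IsCrit γ sc →
        bernR γ sc < r → r < bernR γ 0 →
        (∀ x : ℝ, py ψ x (η x) ≥ Real.sqrt (2 * γ) - δ / γ) →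
        ∀ ystar : ℝ, 0 < ystar → ystar < η 0 → py ψ 0 ystar = 1 / γ →
          ystar < C₃ * Real.sqrt δ / γ ^ 2 := by
  refine ⟨17, by norm_num, fun δ hδ => ⟨100 * δ, by linarith, ?_⟩⟩
  intro γ hγ ψ η r Λ sc hw hu _ _ hr hsurf ys hy0 hy1 hys
  have hγ1 : 100 < γ := by linarith
  have hγ0 : 0 < γ := by linarith
  set s := Real.sqrt γ with hsdef
  have hs2 : s ^ 2 = γ := Real.sq_sqrt hγ0.le
  have hs10 : 10 < s := by
    rw [hsdef]; exact Real.lt_sqrt_of_sq_lt (by linarith)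
  have hs0 : 0 < s := by linarith
  have hδγ : δ / γ ≤ 1 / 100 := by
    rw [div_le_div_iff₀ hγ0 (by norm_num)]; linarith
  have hw1 : 7 / 5 * s ≤ Real.sqrt (2 * γ) := by
    apply Real.le_sqrt_of_sq_le; nlinarith
  have hw2 : Real.sqrt (2 * γ) ≤ γ := by
    apply Real.sqrt_le_iff.mpr; constructor <;> nlinarith
  have hr2 : r ≤ γ + 1 := by
    have e : bernR γ 0 = γ + Real.sqrt (2 * γ) / γ := by simp [bernR, lamDepth]
    have : Real.sqrt (2 * γ) / γ ≤ 1 := (div_le_one hγ0).2 hw2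
    linarith
  have hq : ∀ x, 6 / 5 * s ≤ py ψ x (η x) := by
    intro x
    have := hsurf x
    linarith
  have hsl := surface_slope hw.sol (fun x => ⟨by linarith [hq x], by nlinarith [hq x]⟩)
  have hL2 : 5 ≤ γ * (5 / (2 * s)) ^ 2 := by
    rw [← hs2]; field_simp; norm_num
  have hdep := depth_bound hγ0 hw.sol hu hsl (L := 5 / (2 * s)) (by positivity) hL2
  have hmax : ∀ x, η x * s ≤ 15 / 2 := by
    intro x
    have hp : Function.Periodic η (2 * Λ) := hw.eta_periodic
    have hΛ := hw.lam_pos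
    obtain ⟨a, ha, he⟩ := hp.exists_mem_Ico (by linarith) x (-Λ)
    have h0 : η x ≤ η 0 := by
      have h2 : η |a| = η a := by
        rcases abs_choice a with h | h <;> rw [h]
        exact hw.eta_even a
      rw [he, ← h2]
      exact hw.eta_anti.antitoneOn ⟨le_rfl, hΛ.le⟩
        ⟨abs_nonneg a, abs_le.mpr ⟨ha.1, by linarith [ha.2]⟩⟩ (abs_nonneg a)
    have h1 : η x ≤ 3 * (5 / (2 * s)) := by linarith
    calc η x * s ≤ 3 * (5 / (2 * s)) * s := mul_le_mul_of_nonneg_right h1 hs0.le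
      _ = 15 / 2 := by field_simp; norm_num
  have key := py_lower (A := γ / 16) (κ := γ * s / 120) hw hu (by positivity) (fun x => by
    have h1 := hmax x
    have h2 := hq x
    have h3 := hw.sol.eta_pos x
    have h4 : 0 < η x * s := by positivity
    have e : γ / 16 * η x + γ * s / 120 * η x ^ 2
        = s * ((η x * s) / 16 + (η x * s) ^ 2 / 120) := by rw [← hs2]; ring
    rw [e]
    have : (η x * s) / 16 + (η x * s) ^ 2 / 120 ≤ 6 / 5 := by nlinarith
    nlinarith) 0 ys hy0.le hy1.le
  rw [hys] at key
  have h1 : γ / 16 * ys ≤ 1 / γ := by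
    have : 0 ≤ γ * s / 120 * ys ^ 2 := by positivity
    linarith
  have hδ1 : 1 ≤ Real.sqrt δ := Real.one_le_sqrt.mpr hδ
  rw [lt_div_iff₀ (by positivity)]
  rw [le_div_iff₀ hγ0] at h1
  nlinarith
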